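/- arXiv:1409.8342 — 2 statements merged into one kernel-verified Lean document; each statement's English description precedes it below -/
import Mathlib

section
/- The map i : X → Hom(X, ℤ) given by i(y)(x) = ∑_{s∈S} (w s)·(y s)·(x s) is injective, and its cokernel Hom(X, ℤ)/i(X) is a finite abelian group. -/
open Finset

/-- The group of degree-zero elements of `ℤ^S`. -/
def Xgrp (S : Type*) [Fintype S] : AddSubgroup (S → ℤ) :=
  (AddMonoidHom.mk' (fun x : S → ℤ => ∑ s, x s)
    (by intro x y; simp [Finset.sum_add_distrib])).ker

/-- The monodromy pairing map `i : X → Hom(X, ℤ)`,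
`i(y)(x) = ∑ s, (w s) * (y s) * (x s)`. -/
noncomputable def iPair {S : Type*} [Fintype S] (w : S → ℕ) :
    Xgrp S →+ (Xgrp S →+ ℤ) :=
  AddMonoidHom.mk'
    (fun y => AddMonoidHom.mk'
      (fun x => ∑ s, (w s : ℤ) * (y : S → ℤ) s * (x : S → ℤ) s)
      (by intro x x'; simp [mul_add, Finset.sum_add_distrib]))
    (by
      intro y y'
      ext x
      simp [add_mul, mul_add, Finset.sum_add_distrib])

/-- The functional `φ_s(x) = (w s) * (x s)` on `X`. -/
def phi {S : Type*} [Fintype S] (w : S → ℕ) (s : S) : Xgrp S →+ ℤ :=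
  AddMonoidHom.mk' (fun x => (w s : ℤ) * (x : S → ℤ) s) (by intro x y; simp [mul_add])

/-- The degree-zero element `[s] - [s₀]`. -/
def subSingle {S : Type*} [Fintype S] [DecidableEq S] (s₀ s : S) : Xgrp S :=
  ⟨Pi.single s 1 - Pi.single s₀ 1, by
    change ∑ t, (Pi.single s (1 : ℤ) - Pi.single s₀ 1 : S → ℤ) t = 0
    simp [Finset.sum_sub_distrib]⟩

theorem Xgrp.sum_eq_zero {S : Type*} [Fintype S] (x : Xgrp S) : ∑ s, (x : S → ℤ) s = 0 :=
  x.2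

theorem iPair_apply {S : Type*} [Fintype S] (w : S → ℕ) (y x : Xgrp S) :
    iPair w y x = ∑ s, (w s : ℤ) * (y : S → ℤ) s * (x : S → ℤ) s :=
  rfl

theorem Xgrp.eq_sum_smul_subSingle {S : Type*} [Fintype S] [DecidableEq S] (s₀ : S)
    (x : Xgrp S) : x = ∑ s, (x : S → ℤ) s • subSingle s₀ s := by
  apply Subtype.ext
  funext t
  simp [subSingle, mul_sub, Finset.sum_sub_distrib, Pi.single_apply,
    Xgrp.sum_eq_zero]

theorem apply_eq_sum_subSingle {S : Type*} [Fintype S] [DecidableEq S] (s₀ : S)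
    (f : Xgrp S →+ ℤ) (x : Xgrp S) :
    f x = ∑ s, (x : S → ℤ) s * f (subSingle s₀ s) := by
  conv_lhs => rw [Xgrp.eq_sum_smul_subSingle s₀ x]
  simp

theorem iPair_injective {S : Type*} [Fintype S] (w : S → ℕ) (hw : ∀ s, 0 < w s) :
    Function.Injective (iPair w) := by
  rw [injective_iff_map_eq_zero]
  intro y hy
  have h : ∑ s, (w s : ℤ) * (y : S → ℤ) s * (y : S → ℤ) s = 0 := by
    rw [← iPair_apply, hy, AddMonoidHom.zero_apply]
  rw [Finset.sum_eq_zero_iff_of_nonneg fun s _ => by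
    rw [mul_assoc]; exact mul_nonneg (by positivity) (mul_self_nonneg _)] at h
  apply Subtype.ext
  funext s
  simpa [(hw s).ne'] using h s (Finset.mem_univ s)

theorem exists_smul_mem_range_iPair {S : Type*} [Fintype S] [Nonempty S]
    (w : S → ℕ) (hw : ∀ s, 0 < w s) :
    ∃ N : ℤ, 0 < N ∧ ∀ f : Xgrp S →+ ℤ, N • f ∈ (iPair w).range := by
  classical
  obtain ⟨s₀⟩ := ‹Nonempty S›
  set W : ℤ := ∏ s, (w s : ℤ)
  set V : S → ℤ := fun s => ∏ t ∈ Finset.univ.erase s, (w t : ℤ)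
  have hVpos (s : S) : 0 < V s := Finset.prod_pos fun t _ => by exact_mod_cast hw t
  have hwV (s : S) : (w s : ℤ) * V s = W :=
    Finset.mul_prod_erase _ (fun t => (w t : ℤ)) (Finset.mem_univ s)
  have hWpos : 0 < W := Finset.prod_pos fun t _ => by exact_mod_cast hw t
  refine ⟨W * ∑ s, V s,
    mul_pos hWpos (Finset.sum_pos (fun s _ => hVpos s) ⟨s₀, Finset.mem_univ _⟩), fun f => ?_⟩
  set a : S → ℤ := fun s => f (subSingle s₀ s)
  set c : ℤ := ∑ t, V t * a t
  refine ⟨⟨fun s => V s * ((∑ t, V t) * a s - c), ?_⟩, ?_⟩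
  · change ∑ s, V s * ((∑ t, V t) * a s - c) = 0
    simp only [mul_sub, Finset.sum_sub_distrib, ← Finset.sum_mul, mul_left_comm (V _)]
    rw [← Finset.mul_sum, sub_self]
  · ext x
    rw [iPair_apply, AddMonoidHom.smul_apply, apply_eq_sum_subSingle s₀ f x, smul_eq_mul]
    calc ∑ s, (w s : ℤ) * (V s * ((∑ t, V t) * a s - c)) * (x : S → ℤ) s
        = ∑ s, (W * (∑ t, V t) * ((x : S → ℤ) s * a s) - W * c * (x : S → ℤ) s) := by
          refine Finset.sum_congr rfl fun s _ => ?_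
          rw [← mul_assoc (w s : ℤ), hwV]
          ring
      _ = W * (∑ t, V t) * ∑ s, (x : S → ℤ) s * a s := by
          rw [Finset.sum_sub_distrib, ← Finset.mul_sum, ← Finset.mul_sum,
            Xgrp.sum_eq_zero, mul_zero, sub_zero]

theorem module_finite_dual_Xgrp {S : Type*} [Fintype S] [Nonempty S] :
    Module.Finite ℤ (Xgrp S →+ ℤ) := by
  classical
  obtain ⟨s₀⟩ := ‹Nonempty S›
  let e : (Xgrp S →+ ℤ) →+ (S → ℤ) :=
    AddMonoidHom.mk' (fun f s => f (subSingle s₀ s)) fun _ _ => rfl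
  refine Module.Finite.of_injective e.toIntLinearMap fun f g h => ?_
  ext x
  rw [apply_eq_sum_subSingle s₀ f, apply_eq_sum_subSingle s₀ g]
  exact Finset.sum_congr rfl fun s _ => congrArg _ (congrFun h s)

theorem finite_coker_iPair {S : Type*} [Fintype S] [Nonempty S]
    (w : S → ℕ) (hw : ∀ s, 0 < w s) :
    Finite ((Xgrp S →+ ℤ) ⧸ (iPair w).range) := by
  obtain ⟨N, hN, hmem⟩ := exists_smul_mem_range_iPair w hw
  have := module_finite_dual_Xgrp (S := S)
  have : Module.Finite ℤ ((Xgrp S →+ ℤ) ⧸ (iPair w).range) :=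
    Module.Finite.of_surjective (QuotientAddGroup.mk' (iPair w).range).toIntLinearMap
      (QuotientAddGroup.mk'_surjective _)
  refine Module.finite_of_fg_torsion _ fun q => ?_
  obtain ⟨f, rfl⟩ := QuotientAddGroup.mk'_surjective _ q
  refine ⟨⟨N, mem_nonZeroDivisors_of_ne_zero hN.ne'⟩, ?_⟩
  change N • QuotientAddGroup.mk' (iPair w).range f = 0
  rw [← map_zsmul]
  exact (QuotientAddGroup.eq_zero_iff _).2 (hmem f)

/-- the map `i : X → Hom(X, ℤ)` is injective and its cokernel
`Hom(X, ℤ) / i(X)` is a finite abelian group. -/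
theorem stmt_0 {S : Type*} [Fintype S] (hS : 1 < Fintype.card S)
    (w : S → ℕ) (hw : ∀ s, 0 < w s) :
    Function.Injective (iPair w) ∧
      Finite ((Xgrp S →+ ℤ) ⧸ (iPair w).range) := by
  have : Nonempty S := Fintype.card_pos_iff.1 (by omega)
  exact ⟨iPair_injective w hw, finite_coker_iPair w hw⟩
end

section
/- Let d be a positive integer such that w s divides d for every s ∈ S, and fix s₀ ∈ S. Then for every homomorphism f : X → ℤ, the element d·f lies in the subgroup of Hom(X, ℤ) generated by i(X) together with φ_{s₀}; equivalently, the quotient of Hom(X, ℤ)/i(X) by the cyclic subgroup generated by the image of φ_{s₀} is annihilated by d. -/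
open Finset

lemma mem_Xgrp {S : Type*} [Fintype S] {x : S → ℤ} : x ∈ Xgrp S ↔ ∑ s, x s = 0 := Iff.rfl

/-- Every functional on `X` is the restriction of a functional on `ℤ^S`. -/
lemma exists_forall_eq_sum_mul {S : Type*} [Fintype S] (s₀ : S) (f : Xgrp S →+ ℤ) :
    ∃ g : S → ℤ, ∀ x : Xgrp S, f x = ∑ s, g s * (x : S → ℤ) s := by
  classical
  let e (s : S) : Xgrp S := ⟨Pi.single s 1 - Pi.single s₀ 1, by
    simp [mem_Xgrp, Finset.sum_sub_distrib]⟩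
  refine ⟨fun s => f (e s), fun x => ?_⟩
  have hx : x = ∑ s, (x : S → ℤ) s • e s := by
    have h0 : ∑ s, (x : S → ℤ) s = 0 := x.2
    ext t
    simp [e, Finset.sum_apply, Pi.single_apply, mul_sub, Finset.sum_sub_distrib, h0]
  conv_lhs => rw [hx]
  simp [mul_comm]

/-- if `w s ∣ d` for all `s` and `s₀ ∈ S` is fixed, then for every
homomorphism `f : X → ℤ`, the element `d • f` lies in the subgroup of `Hom(X, ℤ)`
generated by `i(X)` together with `φ_{s₀}`. -/
theorem stmt_3 {S : Type*} [Fintype S] (hS : 1 < Fintype.card S)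
    (w : S → ℕ) (hw : ∀ s, 0 < w s) (d : ℕ) (hd : 0 < d) (hdvd : ∀ s, w s ∣ d)
    (s₀ : S) :
    ∀ f : Xgrp S →+ ℤ,
      d • f ∈ (iPair w).range ⊔ AddSubgroup.zmultiples (phi w s₀) := by
  classical
  intro f
  obtain ⟨g, hg⟩ := exists_forall_eq_sum_mul s₀ f
  choose q hq using hdvd
  let c : ℤ := ∑ s, (q s : ℤ) * g s
  let y : Xgrp S := ⟨fun s => q s * g s - (Pi.single s₀ c : S → ℤ) s, by
    simp [mem_Xgrp, Finset.sum_sub_distrib, c]⟩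
  refine AddSubgroup.mem_sup.2 ⟨iPair w y, ⟨y, rfl⟩, c • phi w s₀, ⟨c, rfl⟩, ?_⟩
  ext x
  have hterm (s : S) : (w s : ℤ) * (q s * g s - (Pi.single s₀ c : S → ℤ) s) * (x : S → ℤ) s =
      d * (g s * (x : S → ℤ) s) - if s = s₀ then c * (w s₀ * (x : S → ℤ) s₀) else 0 := by
    have hs : (d : ℤ) = w s * q s := mod_cast hq s
    rw [hs, Pi.single_apply]
    split_ifs with h
    · subst h; ring
    · ring
  simp [iPair, phi, y, hterm, hg, Finset.sum_sub_distrib, Finset.mul_sum]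
end
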